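/- arXiv:1005.3942 — 2 statements merged into one kernel-verified Lean document; each statement's English description precedes it below -/
import Mathlib

section
/- Let u, v, η : ℝ × ℝ → ℝ be smooth functions with u, v satisfying the Riemann type system u_t = v - u u_x, v_t = -u v_x, and suppose η is nowhere vanishing and satisfies η² = 2 v_x - u_x² everywhere. Then the pair (u, η) satisfies the generalized two-component Hunter–Saxton system: u_{xt} = -½ u_x² - u u_{xx} + ½ η² and η_t = -(u η)_x. -/
/-- Partial derivative in the first (space) variable. -/
noncomputable def pdx (f : ℝ → ℝ → ℝ) : ℝ → ℝ → ℝ := fun x t => deriv (fun y => f y t) x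

/-- Partial derivative in the second (time) variable. -/
noncomputable def pdt (f : ℝ → ℝ → ℝ) : ℝ → ℝ → ℝ := fun x t => deriv (fun s => f x s) t

/-- Smoothness of a function of two real variables. -/
def Smooth2 (f : ℝ → ℝ → ℝ) : Prop := ContDiff ℝ (⊤ : ℕ∞) (fun p : ℝ × ℝ => f p.1 p.2)

theorem Smooth2.hasDerivAt_fst {f : ℝ → ℝ → ℝ} (hf : Smooth2 f) (x t : ℝ) :
    HasDerivAt (fun y => f y t) (fderiv ℝ (fun p : ℝ × ℝ => f p.1 p.2) (x, t) (1, 0)) x := by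
  have h : HasFDerivAt (fun p : ℝ × ℝ => f p.1 p.2) _ (x, t) :=
    ((ContDiff.differentiable hf (by simp)) (x, t)).hasFDerivAt
  exact h.comp_hasDerivAt x ((hasDerivAt_id x).prodMk (hasDerivAt_const x t))

theorem Smooth2.hasDerivAt_snd {f : ℝ → ℝ → ℝ} (hf : Smooth2 f) (x t : ℝ) :
    HasDerivAt (fun s => f x s) (fderiv ℝ (fun p : ℝ × ℝ => f p.1 p.2) (x, t) (0, 1)) t := by
  have h : HasFDerivAt (fun p : ℝ × ℝ => f p.1 p.2) _ (x, t) :=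
    ((ContDiff.differentiable hf (by simp)) (x, t)).hasFDerivAt
  exact h.comp_hasDerivAt t ((hasDerivAt_const t x).prodMk (hasDerivAt_id t))

theorem Smooth2.pdx_eq_fderiv {f : ℝ → ℝ → ℝ} (hf : Smooth2 f) (x t : ℝ) :
    pdx f x t = fderiv ℝ (fun p : ℝ × ℝ => f p.1 p.2) (x, t) (1, 0) :=
  (hf.hasDerivAt_fst x t).deriv

theorem Smooth2.pdt_eq_fderiv {f : ℝ → ℝ → ℝ} (hf : Smooth2 f) (x t : ℝ) :
    pdt f x t = fderiv ℝ (fun p : ℝ × ℝ => f p.1 p.2) (x, t) (0, 1) :=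
  (hf.hasDerivAt_snd x t).deriv

theorem Smooth2.hasDerivAt_pdx {f : ℝ → ℝ → ℝ} (hf : Smooth2 f) (x t : ℝ) :
    HasDerivAt (fun y => f y t) (pdx f x t) x :=
  (hf.hasDerivAt_fst x t).differentiableAt.hasDerivAt

theorem Smooth2.hasDerivAt_pdt {f : ℝ → ℝ → ℝ} (hf : Smooth2 f) (x t : ℝ) :
    HasDerivAt (fun s => f x s) (pdt f x t) t :=
  (hf.hasDerivAt_snd x t).differentiableAt.hasDerivAt

theorem Smooth2.contDiff_fderiv {f : ℝ → ℝ → ℝ} (hf : Smooth2 f) :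
    ContDiff ℝ (⊤ : ℕ∞) (fderiv ℝ (fun p : ℝ × ℝ => f p.1 p.2)) :=
  ContDiff.fderiv_right hf (by simp)

theorem Smooth2.smooth2_pdx {f : ℝ → ℝ → ℝ} (hf : Smooth2 f) : Smooth2 (pdx f) := by
  simpa only [Smooth2, hf.pdx_eq_fderiv] using hf.contDiff_fderiv.clm_apply contDiff_const

theorem Smooth2.smooth2_pdt {f : ℝ → ℝ → ℝ} (hf : Smooth2 f) : Smooth2 (pdt f) := by
  simpa only [Smooth2, hf.pdt_eq_fderiv] using hf.contDiff_fderiv.clm_apply contDiff_const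

/-- Mixed partial derivatives of a smooth function commute. -/
theorem Smooth2.pdt_pdx_comm {f : ℝ → ℝ → ℝ} (hf : Smooth2 f) (x t : ℝ) :
    pdt (pdx f) x t = pdx (pdt f) x t := by
  have hd : DifferentiableAt ℝ (fderiv ℝ (fun p : ℝ × ℝ => f p.1 p.2)) (x, t) :=
    hf.contDiff_fderiv.differentiable (by simp) (x, t)
  have hsymm : IsSymmSndFDerivAt ℝ (fun p : ℝ × ℝ => f p.1 p.2) (x, t) :=
    (ContDiff.contDiffAt hf).isSymmSndFDerivAt (by
      rw [minSmoothness_of_isRCLikeNormedField]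
      exact WithTop.coe_le_coe.2 (le_top : (2 : ℕ∞) ≤ ⊤))
  rw [hf.smooth2_pdx.pdt_eq_fderiv, hf.smooth2_pdt.pdx_eq_fderiv]
  simp only [hf.pdx_eq_fderiv, hf.pdt_eq_fderiv, Prod.mk.eta]
  rw [fderiv_clm_apply hd (differentiableAt_const _),
    fderiv_clm_apply hd (differentiableAt_const _)]
  simpa using hsymm (0, 1) (1, 0)

/-- the `N = 2` Riemann type system transforms into the generalized
two-component Hunter–Saxton system: if `u_t = v - u u_x`, `v_t = -u v_x` and
`η² = 2 v_x - u_x²` with `η` nowhere vanishing, then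
`u_{xt} = -½ u_x² - u u_{xx} + ½ η²` and `η_t = -(u η)_x`. -/
theorem statement8 (u v eta : ℝ → ℝ → ℝ)
    (hu : Smooth2 u) (hv : Smooth2 v) (heta : Smooth2 eta)
    (sys1 : ∀ x t, pdt u x t = v x t - u x t * pdx u x t)
    (sys2 : ∀ x t, pdt v x t = -(u x t) * pdx v x t)
    (hne : ∀ x t, eta x t ≠ 0)
    (hsub : ∀ x t, (eta x t) ^ 2 = 2 * pdx v x t - (pdx u x t) ^ 2) :
    (∀ x t, pdt (pdx u) x t
        = -(1/2) * (pdx u x t) ^ 2 - u x t * pdx (pdx u) x t + (1/2) * (eta x t) ^ 2)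
    ∧ (∀ x t, pdt eta x t = -(pdx (fun x t => u x t * eta x t) x t)) := by
  have hux := hu.smooth2_pdx
  have hvx := hv.smooth2_pdx
  have uxt (x t : ℝ) : pdt (pdx u) x t
      = pdx v x t - (pdx u x t * pdx u x t + u x t * pdx (pdx u) x t) := by
    rw [hu.pdt_pdx_comm, show pdt u = fun x t => v x t - u x t * pdx u x t from
      funext₂ sys1]
    exact ((hv.hasDerivAt_pdx x t).sub
      ((hu.hasDerivAt_pdx x t).mul (hux.hasDerivAt_pdx x t))).deriv
  have vxt (x t : ℝ) : pdt (pdx v) x t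
      = -(pdx u x t) * pdx v x t + -(u x t) * pdx (pdx v) x t := by
    rw [hv.pdt_pdx_comm, show pdt v = fun x t => -(u x t) * pdx v x t from funext₂ sys2]
    exact ((hu.hasDerivAt_pdx x t).neg.mul (hvx.hasDerivAt_pdx x t)).deriv
  refine ⟨fun x t => by rw [uxt, hsub]; ring, fun x t => ?_⟩
  have hx := (heta.hasDerivAt_pdx x t).pow 2
  have ht := (heta.hasDerivAt_pdt x t).pow 2
  have hx' := ((hvx.hasDerivAt_pdx x t).const_mul 2).sub ((hux.hasDerivAt_pdx x t).pow 2)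
  have ht' := ((hvx.hasDerivAt_pdt x t).const_mul 2).sub ((hux.hasDerivAt_pdt x t).pow 2)
  have ex := hx.unique (hx'.congr_of_eventuallyEq (.of_forall fun y => hsub y t))
  have et := ht.unique (ht'.congr_of_eventuallyEq (.of_forall fun s => hsub x s))
  have hprod : pdx (fun x t => u x t * eta x t) x t
      = pdx u x t * eta x t + u x t * pdx eta x t :=
    ((hu.hasDerivAt_pdx x t).mul (heta.hasDerivAt_pdx x t)).deriv
  rw [uxt, vxt] at et
  rw [hprod]
  apply mul_left_cancel₀ (hne x t)
  norm_num at ex et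
  linear_combination et / 2 + u x t * ex / 2 + pdx u x t * hsub x t
end

section
/- Let u, v, w, z : ℝ × ℝ → ℝ be smooth functions, 2π-periodic in x, satisfying u_t = v - u u_x, v_t = w - u v_x, w_t = z - u w_x, z_t = -u z_x. Then the functional H^{(20)}(t) = ∫₀^{2π} (z_x w - z w_x) dx is constant in t. -/
namespace Smooth2

variable {f g : ℝ → ℝ → ℝ}

theorem differentiable (hf : Smooth2 f) : Differentiable ℝ fun p : ℝ × ℝ => f p.1 p.2 :=
  ContDiff.differentiable hf (by simp)

theorem continuous (hf : Smooth2 f) : Continuous fun p : ℝ × ℝ => f p.1 p.2 :=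
  ContDiff.continuous hf

theorem mul (hf : Smooth2 f) (hg : Smooth2 g) : Smooth2 fun x t => f x t * g x t :=
  ContDiff.mul hf hg

theorem sub (hf : Smooth2 f) (hg : Smooth2 g) : Smooth2 fun x t => f x t - g x t :=
  ContDiff.sub hf hg

theorem pdx_eq_fderiv_s18 (hf : Smooth2 f) (x t : ℝ) :
    pdx f x t = fderiv ℝ (fun p : ℝ × ℝ => f p.1 p.2) (x, t) (1, 0) := by
  have h : HasDerivAt (fun y : ℝ => (y, t)) (1, 0) x :=
    (hasDerivAt_id x).prodMk (hasDerivAt_const x t)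
  exact ((hf.differentiable (x, t)).hasFDerivAt.comp_hasDerivAt x h).deriv

theorem pdt_eq_fderiv_s18 (hf : Smooth2 f) (x t : ℝ) :
    pdt f x t = fderiv ℝ (fun p : ℝ × ℝ => f p.1 p.2) (x, t) (0, 1) := by
  have h : HasDerivAt (fun s : ℝ => (x, s)) (0, 1) t :=
    (hasDerivAt_const t x).prodMk (hasDerivAt_id t)
  exact ((hf.differentiable (x, t)).hasFDerivAt.comp_hasDerivAt t h).deriv

theorem hasDerivAt_pdx_s18 (hf : Smooth2 f) (x t : ℝ) :
    HasDerivAt (fun y => f y t) (pdx f x t) x := by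
  have h : Differentiable ℝ fun y : ℝ => (y, t) := by fun_prop
  exact (hf.differentiable.comp h x).hasDerivAt

theorem hasDerivAt_pdt_s18 (hf : Smooth2 f) (x t : ℝ) :
    HasDerivAt (fun s => f x s) (pdt f x t) t := by
  have h : Differentiable ℝ fun s : ℝ => (x, s) := by fun_prop
  exact (hf.differentiable.comp h t).hasDerivAt

theorem contDiff_fderiv_apply (hf : Smooth2 f) (e : ℝ × ℝ) :
    ContDiff ℝ (⊤ : ℕ∞) fun p => fderiv ℝ (fun p : ℝ × ℝ => f p.1 p.2) p e :=
  (ContDiff.fderiv_right hf (by simp)).clm_apply contDiff_const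

theorem pdx (hf : Smooth2 f) : Smooth2 (pdx f) := by
  simpa only [Smooth2, hf.pdx_eq_fderiv_s18] using hf.contDiff_fderiv_apply (1, 0)

theorem pdt (hf : Smooth2 f) : Smooth2 (pdt f) := by
  simpa only [Smooth2, hf.pdt_eq_fderiv_s18] using hf.contDiff_fderiv_apply (0, 1)

theorem pdt_pdx_comm_s18 (hf : Smooth2 f) (x t : ℝ) :
    _root_.pdt (_root_.pdx f) x t = _root_.pdx (_root_.pdt f) x t := by
  have hd : DifferentiableAt ℝ (fderiv ℝ fun p : ℝ × ℝ => f p.1 p.2) (x, t) :=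
    (ContDiff.fderiv_right (m := (⊤ : ℕ∞)) hf (by simp)).differentiable (by simp) _
  have hsymm : IsSymmSndFDerivAt ℝ (fun p : ℝ × ℝ => f p.1 p.2) (x, t) :=
    (ContDiff.contDiffAt hf).isSymmSndFDerivAt <| by
      simpa using WithTop.coe_le_coe.2 (le_top : (2 : ℕ∞) ≤ ⊤)
  rw [hf.pdx.pdt_eq_fderiv_s18, hf.pdt.pdx_eq_fderiv_s18]
  simp only [hf.pdx_eq_fderiv_s18, hf.pdt_eq_fderiv_s18, Prod.mk.eta]
  rw [fderiv_clm_apply hd (differentiableAt_const _), fderiv_clm_apply hd (differentiableAt_const _)]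
  simpa using hsymm.eq (0, 1) (1, 0)

end Smooth2

theorem pdx_periodic {f : ℝ → ℝ → ℝ} {c t : ℝ} (hf : Function.Periodic (fun x => f x t) c) :
    Function.Periodic (fun x => pdx f x t) c := fun x => by
  have h : (fun y => f (y + c) t) = fun y => f y t := funext hf
  simpa only [pdx, h] using (deriv_comp_add_const (fun y => f y t) c x).symm

/-- A local conservation law `ρ_t + φ_x = 0` whose flux agrees at the endpoints conserves the
integral of the density. -/
theorem integral_eq_of_pdt_add_pdx_eq_zero {ρ φ : ℝ → ℝ → ℝ} (hρ : Smooth2 ρ) (hφ : Smooth2 φ)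
    {a b : ℝ} (hab : ∀ t, φ b t = φ a t) (h : ∀ x t, pdx φ x t + pdt ρ x t = 0) (t₁ t₂ : ℝ) :
    ∫ x in a..b, ρ x t₁ = ∫ x in a..b, ρ x t₂ := by
  have hdiv : ∀ p : ℝ × ℝ, fderiv ℝ (fun p : ℝ × ℝ => φ p.1 p.2) p (1, 0) +
      fderiv ℝ (fun p : ℝ × ℝ => ρ p.1 p.2) p (0, 1) = 0 := fun p => by
    simpa only [hφ.pdx_eq_fderiv_s18, hρ.pdt_eq_fderiv_s18] using h p.1 p.2
  have key := MeasureTheory.integral2_divergence_prod_of_hasFDerivAt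
    (fun p : ℝ × ℝ => φ p.1 p.2) (fun p : ℝ × ℝ => ρ p.1 p.2)
    (fderiv ℝ fun p : ℝ × ℝ => φ p.1 p.2) (fderiv ℝ fun p : ℝ × ℝ => ρ p.1 p.2)
    a t₁ b t₂ hφ.continuous.continuousOn hρ.continuous.continuousOn
    (fun p _ => (hφ.differentiable p).hasFDerivAt) (fun p _ => (hρ.differentiable p).hasFDerivAt)
    (by simp only [hdiv]; exact MeasureTheory.integrableOn_zero)
  simp only [hdiv, hab, intervalIntegral.integral_zero] at key
  linarith

/-- the polynomial conservation law
`H^{(20)} = ∫₀^{2π} (z_x w - z w_x) dx` for the `N = 4` Riemann type system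
`u_t = v - u u_x`, `v_t = w - u v_x`, `w_t = z - u w_x`, `z_t = -u z_x`. -/
theorem statement18 (u v w z : ℝ → ℝ → ℝ)
    (hu : Smooth2 u) (hv : Smooth2 v) (hw : Smooth2 w) (hz : Smooth2 z)
    (huper : ∀ t, Function.Periodic (fun x => u x t) (2 * Real.pi))
    (hvper : ∀ t, Function.Periodic (fun x => v x t) (2 * Real.pi))
    (hwper : ∀ t, Function.Periodic (fun x => w x t) (2 * Real.pi))
    (hzper : ∀ t, Function.Periodic (fun x => z x t) (2 * Real.pi))
    (sys1 : ∀ x t, pdt u x t = v x t - u x t * pdx u x t)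
    (sys2 : ∀ x t, pdt v x t = w x t - u x t * pdx v x t)
    (sys3 : ∀ x t, pdt w x t = z x t - u x t * pdx w x t)
    (sys4 : ∀ x t, pdt z x t = -(u x t) * pdx z x t) :
    ∀ t₁ t₂ : ℝ,
      (∫ x in (0:ℝ)..(2 * Real.pi), pdx z x t₁ * w x t₁ - z x t₁ * pdx w x t₁)
        = ∫ x in (0:ℝ)..(2 * Real.pi), pdx z x t₂ * w x t₂ - z x t₂ * pdx w x t₂ := by
  have hρ := (hz.pdx.mul hw).sub (hz.mul hw.pdx)
  refine integral_eq_of_pdt_add_pdx_eq_zero hρ (hu.mul hρ) (fun t => ?_) fun x t => ?_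
  · have hu0 := huper t 0
    have hw0 := hwper t 0
    have hz0 := hzper t 0
    have hwx := pdx_periodic (hwper t) 0
    have hzx := pdx_periodic (hzper t) 0
    simp only [zero_add] at hu0 hw0 hz0 hwx hzx
    rw [hu0, hw0, hz0, hwx, hzx]
  · have hφx := ((hu.hasDerivAt_pdx_s18 x t).mul
      (((hz.pdx.hasDerivAt_pdx_s18 x t).mul (hw.hasDerivAt_pdx_s18 x t)).sub
        ((hz.hasDerivAt_pdx_s18 x t).mul (hw.pdx.hasDerivAt_pdx_s18 x t)))).deriv
    have hρt := (((hz.pdx.hasDerivAt_pdt_s18 x t).mul (hw.hasDerivAt_pdt_s18 x t)).sub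
      ((hz.hasDerivAt_pdt_s18 x t).mul (hw.pdx.hasDerivAt_pdt_s18 x t))).deriv
    have hzxt : pdt (pdx z) x t = -(pdx u x t * pdx z x t + u x t * pdx (pdx z) x t) := by
      rw [hz.pdt_pdx_comm_s18, funext₂ sys4]
      simp only [neg_mul]
      exact ((hu.hasDerivAt_pdx_s18 x t).mul (hz.pdx.hasDerivAt_pdx_s18 x t)).neg.deriv
    have hwxt : pdt (pdx w) x t =
        pdx z x t - (pdx u x t * pdx w x t + u x t * pdx (pdx w) x t) := by
      rw [hw.pdt_pdx_comm_s18, funext₂ sys3]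
      exact ((hz.hasDerivAt_pdx_s18 x t).sub
        ((hu.hasDerivAt_pdx_s18 x t).mul (hw.pdx.hasDerivAt_pdx_s18 x t))).deriv
    refine (congrArg₂ (· + ·) hφx hρt).trans ?_
    simp only [hzxt, hwxt, sys3, sys4, Pi.mul_apply, Pi.sub_apply]
    ring
end
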